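/- arXiv:2402.15914 — 2 statements merged into one kernel-verified Lean document; each statement's English description precedes it below -/
import Mathlib

section
/- Let n, k, p, q be integers with n ≥ 2, k ≥ 1, 1 ≤ p ≤ q, gcd(p, q) = 1, and not (k = 1 and p = 1). Then the inequality k/n + 1/p + 1/q > k holds in ℚ if and only if at least one of the following holds: (i) k = 2, p = 1, q = 1; (ii) k = 2, p = 1, n = 2; (iii) k = 3, p = 1, q = 1, n = 2; (iv) k = 2, p = 1, q = 2, n = 3; (v) k = 1, p = 2, n = 2; (vi) k = 1, p = 2, q = 3, n ≤ 5; (vii) k = 1, p = 2, q = 5, n = 3; (viii) k = 1, p = 3, (q = 4 or q = 5), n = 2. -/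
/-- Clearing denominators in the inequality `k / n + 1 / p + 1 / q > k`. -/
lemma orbifold_ineq_iff_int {n k p q : ℤ} (hn : 0 < n) (hp : 0 < p) (hq : 0 < q) :
    (k : ℚ) / (n : ℚ) + 1 / (p : ℚ) + 1 / (q : ℚ) > (k : ℚ) ↔
      k * (n - 1) * (p * q) < n * (p + q) := by
  have hn' : (0 : ℚ) < n := by exact_mod_cast hn
  have hp' : (0 : ℚ) < p := by exact_mod_cast hp
  have hq' : (0 : ℚ) < q := by exact_mod_cast hq
  have key : (k : ℚ) / n + 1 / p + 1 / q - k =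
      ((n * (p + q) - k * (n - 1) * (p * q) : ℤ) : ℚ) / (n * p * q) := by
    push_cast
    field_simp
    ring
  rw [gt_iff_lt, ← sub_pos, key, div_pos_iff_of_pos_right (by positivity), Int.cast_pos, sub_pos]

/-- The integral form of the inequality bounds `k * p`. -/
lemma mul_lt_four_of_orbifold_ineq {n k p q : ℤ} (hn : 2 ≤ n) (hp : 1 ≤ p) (hpq : p ≤ q)
    (h : k * (n - 1) * (p * q) < n * (p + q)) : k * p < 4 := by
  have h1 : (n - 1) * (k * (p * q)) < (n - 1) * (2 * (p + q)) := by nlinarith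
  have h2 : k * (p * q) < 2 * (p + q) := lt_of_mul_lt_mul_left h1 (by linarith)
  have h3 : (k * p) * q < 4 * q := by linarith
  exact lt_of_mul_lt_mul_right h3 (by linarith)

theorem stmt_0 (n k p q : ℤ) (hn : 2 ≤ n) (hk : 1 ≤ k) (hp : 1 ≤ p) (hpq : p ≤ q)
    (hgcd : Int.gcd p q = 1) (hne : ¬(k = 1 ∧ p = 1)) :
    (k : ℚ) / (n : ℚ) + 1 / (p : ℚ) + 1 / (q : ℚ) > (k : ℚ) ↔
      (k = 2 ∧ p = 1 ∧ q = 1) ∨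
      (k = 2 ∧ p = 1 ∧ n = 2) ∨
      (k = 3 ∧ p = 1 ∧ q = 1 ∧ n = 2) ∨
      (k = 2 ∧ p = 1 ∧ q = 2 ∧ n = 3) ∨
      (k = 1 ∧ p = 2 ∧ n = 2) ∨
      (k = 1 ∧ p = 2 ∧ q = 3 ∧ n ≤ 5) ∨
      (k = 1 ∧ p = 2 ∧ q = 5 ∧ n = 3) ∨
      (k = 1 ∧ p = 3 ∧ (q = 4 ∨ q = 5) ∧ n = 2) := by
  rw [orbifold_ineq_iff_int (by linarith) (by linarith) (by linarith)]
  constructor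
  · intro h
    have hkp := mul_lt_four_of_orbifold_ineq hn hp hpq h
    have hk3 : k ≤ 3 := by nlinarith
    have hp3 : p ≤ 3 := by nlinarith
    have hq_ne : 2 ≤ p → q ≠ p := by
      rintro h2 rfl
      rw [Int.gcd_self] at hgcd
      omega
    have hq_four : p = 2 → q ≠ 4 := by
      rintro rfl rfl
      norm_num at hgcd
    obtain ⟨rfl, rfl⟩ | ⟨rfl, rfl⟩ | ⟨rfl, rfl⟩ | ⟨rfl, rfl⟩ :
        (k = 1 ∧ p = 2) ∨ (k = 1 ∧ p = 3) ∨ (k = 2 ∧ p = 1) ∨ (k = 3 ∧ p = 1) := by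
      interval_cases k <;> interval_cases p <;> omega
    · have hq : 3 ≤ q := by omega
      have hfac : (n - 2) * (q - 2) < 4 := by linarith
      obtain rfl | hn3 := hn.eq_or_lt
      · simp
      · have hq5 : q ≤ 5 := by nlinarith
        interval_cases q <;> omega
    · have hq : 4 ≤ q := by omega
      have hn2 : n = 2 := by nlinarith
      subst hn2
      omega
    · have hfac : (n - 2) * (q - 1) < 2 := by linarith
      obtain rfl | hn3 := hn.eq_or_lt
      · simp
      · have hq2 : q ≤ 2 := by nlinarith
        interval_cases q <;> omega
    · have hn2 : n = 2 := by nlinarith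
      subst hn2
      omega
  · rintro (⟨rfl, rfl, rfl⟩ | ⟨rfl, rfl, rfl⟩ | ⟨rfl, rfl, rfl, rfl⟩ | ⟨rfl, rfl, rfl, rfl⟩ |
      ⟨rfl, rfl, rfl⟩ | ⟨rfl, rfl, rfl, h⟩ | ⟨rfl, rfl, rfl, rfl⟩ | ⟨rfl, rfl, rfl | rfl, rfl⟩) <;>
      omega
end

section
/- Let n, k be integers with n ≥ 2, k ≥ 1, and let p, q be integers with 1 ≤ p ≤ q and gcd(p, q) = 1. Then the equality k/n + 1/p + 1/q = k holds in ℚ if and only if the quadruple (k, p, q, n) is one of (1, 2, 3, 6), (2, 1, 2, 4), (2, 1, 3, 3), (3, 1, 2, 2), (3, 1, 1, 3), (4, 1, 1, 2). -/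
theorem cleared_denominators_of_eq {n k p q : ℤ} (hn : 2 ≤ n) (hp : 1 ≤ p) (hq : 1 ≤ q)
    (h : (k : ℚ) / (n : ℚ) + 1 / (p : ℚ) + 1 / (q : ℚ) = (k : ℚ)) :
    k * (n - 1) * (p * q) = n * (p + q) := by
  have hn' : (n : ℚ) ≠ 0 := by exact_mod_cast (by lia : n ≠ 0)
  have hp' : (p : ℚ) ≠ 0 := by exact_mod_cast (by lia : p ≠ 0)
  have hq' : (q : ℚ) ≠ 0 := by exact_mod_cast (by lia : q ≠ 0)
  field_simp at h
  have h' : (k : ℚ) * (n - 1) * (p * q) = n * (p + q) := by linear_combination -h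
  exact_mod_cast h'

theorem solutions_of_eq_one {n k q : ℤ} (hn : 2 ≤ n) (hk : 1 ≤ k) (hq : 1 ≤ q)
    (h : k * (n - 1) * q = n * (1 + q)) :
    (k = 2 ∧ q = 2 ∧ n = 4) ∨ (k = 2 ∧ q = 3 ∧ n = 3) ∨ (k = 3 ∧ q = 2 ∧ n = 2) ∨
      (k = 3 ∧ q = 1 ∧ n = 3) ∨ (k = 4 ∧ q = 1 ∧ n = 2) := by
  have hpos : 0 < (n - 1) * q := by apply mul_pos <;> lia
  have hk4 : k ≤ 4 := by
    have : k * ((n - 1) * q) ≤ 4 * ((n - 1) * q) := by nlinarith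
    exact le_of_mul_le_mul_right this hpos
  interval_cases k
  · nlinarith
  · have hprod : (n - 2) * (q - 1) = 2 := by linarith
    have hn4 : n ≤ 4 := by
      have := Int.le_of_dvd (by norm_num) (Dvd.intro _ hprod)
      lia
    interval_cases n <;> lia
  · have hprod : (2 * n - 3) * (2 * q - 1) = 3 := by linarith
    have hn3 : n ≤ 3 := by
      have := Int.le_of_dvd (by norm_num) (Dvd.intro _ hprod)
      lia
    interval_cases n <;> lia
  · have hq1 : q = 1 := by nlinarith
    subst hq1
    lia

theorem solutions_of_two_le {n k p q : ℤ} (hn : 2 ≤ n) (hk : 1 ≤ k) (hp : 2 ≤ p) (hpq : p < q)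
    (hgcd : Int.gcd p q = 1) (h : k * (n - 1) * (p * q) = n * (p + q)) :
    k = 1 ∧ p = 2 ∧ q = 3 ∧ n = 6 := by
  have hpq_pos : 0 < p * q := by apply mul_pos <;> lia
  have hsum : p + q < p * q := by nlinarith
  have hk1 : k = 1 := by
    by_contra hne
    have hle : n ≤ k * (n - 1) := by nlinarith [(by lia : 2 ≤ k)]
    nlinarith [mul_le_mul_of_nonneg_right hle hpq_pos.le]
  subst hk1
  have hp3 : p ≤ 3 := by
    by_contra! hlt
    have h4 : 4 * q ≤ p * q := by nlinarith
    nlinarith [mul_le_mul_of_nonneg_left h4 (by lia : 0 ≤ n - 1)]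
  interval_cases p
  · have hprod : (q - 2) * (n - 2) = 4 := by linarith
    have hq6 : q ≤ 6 := by
      have := Int.le_of_dvd (by norm_num) (Dvd.intro _ hprod)
      lia
    interval_cases q
    · lia
    · norm_num at hgcd
    · lia
    · norm_num at hgcd
  · have hn2 : n = 2 := by nlinarith
    subst hn2
    have hq6 : q = 6 := by lia
    subst hq6
    norm_num at hgcd

theorem stmt_1 (n k p q : ℤ) (hn : 2 ≤ n) (hk : 1 ≤ k) (hp : 1 ≤ p) (hpq : p ≤ q)
    (hgcd : Int.gcd p q = 1) :
    (k : ℚ) / (n : ℚ) + 1 / (p : ℚ) + 1 / (q : ℚ) = (k : ℚ) ↔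
      (k, p, q, n) = (1, 2, 3, 6) ∨
      (k, p, q, n) = (2, 1, 2, 4) ∨
      (k, p, q, n) = (2, 1, 3, 3) ∨
      (k, p, q, n) = (3, 1, 2, 2) ∨
      (k, p, q, n) = (3, 1, 1, 3) ∨
      (k, p, q, n) = (4, 1, 1, 2) := by
  simp only [Prod.mk.injEq]
  constructor
  · intro h
    have hint := cleared_denominators_of_eq hn hp (hp.trans hpq) h
    rcases hp.eq_or_lt with rfl | hp2
    · right
      simpa using solutions_of_eq_one hn hk hpq (by simpa using hint)
    · have hlt : p < q := by
        refine lt_of_le_of_ne hpq ?_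
        rintro rfl
        rw [Int.gcd_self] at hgcd
        lia
      exact Or.inl (solutions_of_two_le hn hk hp2 hlt hgcd hint)
  · rintro (⟨rfl, rfl, rfl, rfl⟩ | ⟨rfl, rfl, rfl, rfl⟩ | ⟨rfl, rfl, rfl, rfl⟩ |
      ⟨rfl, rfl, rfl, rfl⟩ | ⟨rfl, rfl, rfl, rfl⟩ | ⟨rfl, rfl, rfl, rfl⟩) <;> norm_num
end
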